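/- Let H > 0, let ρ be a σ-finite measure on (0,∞) with ∫₀^∞ x ρ(dx) < ∞, and let (ψ(t))_{t≥0} be a nonnegative stochastic process on a probability space (Ω, P) such that E[exp(−∑_{i=1}^n αᵢ ψ(tᵢ))] = exp(−∫_{−∞}^{∞} ∫₀^∞ (1 − exp(−∑_{i=1}^n αᵢ x e^{−s} 1_{[e^{−s/H},∞)}(tᵢ))) ρ(dx) ds) for all n ≥ 1, 0 ≤ t₁ < … < tₙ and α₁,…,αₙ ≥ 0. Then for every a > 0 and all such times and coefficients: E[exp(−∑_{i=1}^n αᵢ (ψ(tᵢ ∨ a) − ψ(a)))] = exp(−∫_{−∞}^{−H ln a} ∫₀^∞ (1 − exp(−∑_{i=1}^n αᵢ x e^{−s} 1_{[e^{−s/H},∞)}(tᵢ))) ρ(dx) ds). That is, the process (ψ(t∨a) − ψ(a))_{t≥0}, which realizes the conditional law of ψ given ψ(a) = 0, has Lévy measure ν_a(F) = ∫_{−∞}^{ln(a^{−H})} ∫₀^∞ F(x e^{−s} 1_{[e^{−s/H},∞)}) ρ(dx) ds, the restriction of the Lévy measure of ψ to paths vanishing at a. -/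

import Mathlib

open MeasureTheory ProbabilityTheory Set
open scoped ENNReal NNReal

open BoundedContinuousFunction in
/-- A finite measure on `ℝ≥0` is determined by its Laplace transform at the natural numbers. -/
theorem ext_of_integral_exp_neg_nat_mul_eq {μ ν : Measure ℝ≥0} [IsFiniteMeasure μ]
    [IsFiniteMeasure ν]
    (h : ∀ n : ℕ, ∫ x : ℝ≥0, Real.exp (-(n * (x : ℝ))) ∂μ =
      ∫ x : ℝ≥0, Real.exp (-(n * (x : ℝ))) ∂ν) : μ = ν := by
  let e : ℝ≥0 →ᵇ ℝ := BoundedContinuousFunction.ofNormedAddCommGroup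
    (fun x : ℝ≥0 ↦ Real.exp (-(x : ℝ))) (by fun_prop) 1 (fun x ↦ by
      rw [Real.norm_eq_abs, Real.abs_exp, Real.exp_le_one_iff]
      simp)
  let A : StarSubalgebra ℝ (ℝ≥0 →ᵇ ℝ) :=
    { (Polynomial.aeval e).range with
      star_mem' := fun {g} hg ↦ by
        have : star g = g := by ext x; simp
        rwa [this] }
  refine ext_of_forall_mem_subalgebra_integral_eq_of_polish (A := A) ?_ ?_
  · intro x y hxy
    refine ⟨e, ⟨toContinuousMapStarₐ ℝ e, ⟨e, ⟨Polynomial.X, by simp⟩, rfl⟩, rfl⟩, ?_⟩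
    intro hexp
    have : Real.exp (-(x : ℝ)) = Real.exp (-(y : ℝ)) := hexp
    exact hxy (NNReal.coe_injective (neg_injective (Real.exp_injective this)))
  · rintro _ ⟨p, rfl⟩
    change ∫ x, (Polynomial.aeval e p) x ∂μ = ∫ x, (Polynomial.aeval e p) x ∂ν
    induction p using Polynomial.induction_on' with
    | add p q hp hq =>
      simp only [map_add, BoundedContinuousFunction.add_apply]
      rw [integral_add (BoundedContinuousFunction.integrable _ _)
          (BoundedContinuousFunction.integrable _ _),
        integral_add (BoundedContinuousFunction.integrable _ _)
          (BoundedContinuousFunction.integrable _ _), hp, hq]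
    | monomial k r =>
      have hk (x : ℝ≥0) : (Polynomial.aeval e (Polynomial.monomial k r)) x =
          r * Real.exp (-(k * (x : ℝ))) := by
        rw [Polynomial.aeval_monomial, ← Algebra.smul_def]
        have : e x = Real.exp (-(x : ℝ)) := rfl
        simp [this, ← Real.exp_nat_mul]
      simp only [hk, integral_const_mul, h k]

/-- If `Y ≥ 0` satisfies `E[e^{-(β + A) Z} Y] = c E[e^{-(β + A) Z}]` for all `β ≥ 0`, then
`E[Y] = c`. -/
theorem integral_eq_of_tilted_laplace_eq {Ω : Type*} [MeasurableSpace Ω] {P : Measure Ω}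
    [IsProbabilityMeasure P] {Y Z : Ω → ℝ} {A c : ℝ} (hY : Measurable Y) (hY0 : ∀ ω, 0 ≤ Y ω)
    (hZ : Measurable Z) (hZ0 : ∀ ω, 0 ≤ Z ω) (hA : 0 ≤ A) (hc : 0 ≤ c)
    (hint : Integrable (fun ω ↦ Real.exp (-(A * Z ω)) * Y ω) P)
    (h : ∀ β, 0 ≤ β → ∫ ω, Real.exp (-((β + A) * Z ω)) * Y ω ∂P =
      c * ∫ ω, Real.exp (-((β + A) * Z ω)) ∂P) :
    ∫ ω, Y ω ∂P = c := by
  let Z' : Ω → ℝ≥0 := fun ω ↦ (Z ω).toNNReal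
  have hZ' : Measurable Z' := hZ.real_toNNReal
  have hcoe (ω) : (Z' ω : ℝ) = Z ω := Real.coe_toNNReal _ (hZ0 ω)
  have hexp : Integrable (fun ω ↦ Real.exp (-(A * Z ω)) * c) P := by
    refine Integrable.mul_const (.of_bound (C := 1) (by fun_prop) (ae_of_all _ fun ω ↦ ?_)) _
    rw [Real.norm_eq_abs, Real.abs_exp, Real.exp_le_one_iff]
    have := mul_nonneg hA (hZ0 ω)
    linarith
  let w (g : Ω → ℝ) (ω : Ω) : ℝ≥0∞ := ENNReal.ofReal (Real.exp (-(A * Z ω)) * g ω)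
  have hw {g : Ω → ℝ} (hg : Measurable g) : Measurable (w g) := by fun_prop
  have hlap {g : Ω → ℝ} (hg : Measurable g) (hg0 : ∀ ω, 0 ≤ g ω) (n : ℕ) :
      ∫ x : ℝ≥0, Real.exp (-(n * (x : ℝ))) ∂((P.withDensity (w g)).map Z') =
        ∫ ω, Real.exp (-((n + A) * Z ω)) * g ω ∂P := by
    rw [integral_map hZ'.aemeasurable (by fun_prop),
      integral_withDensity_eq_integral_toReal_smul (hw hg) (ae_of_all _ fun _ ↦ by simp [w])]
    refine integral_congr_ae (ae_of_all _ fun ω ↦ ?_)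
    simp only [w, hcoe, smul_eq_mul]
    rw [ENNReal.toReal_ofReal (mul_nonneg (Real.exp_pos _).le (hg0 ω)), mul_right_comm,
      ← Real.exp_add]
    ring_nf
  have huntilt {g : Ω → ℝ} (hg : Measurable g) :
      ∫⁻ x : ℝ≥0, ENNReal.ofReal (Real.exp (A * x)) ∂((P.withDensity (w g)).map Z') =
        ∫⁻ ω, ENNReal.ofReal (g ω) ∂P := by
    rw [lintegral_map (by fun_prop) hZ', lintegral_withDensity_eq_lintegral_mul _ (hw hg)
      (by fun_prop)]
    refine lintegral_congr fun ω ↦ ?_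
    simp only [w, hcoe, Pi.mul_apply]
    rw [mul_comm, ← ENNReal.ofReal_mul (Real.exp_pos _).le, ← mul_assoc, ← Real.exp_add]
    simp
  have : IsFiniteMeasure (P.withDensity (w Y)) := isFiniteMeasure_withDensity_ofReal hint.2
  have : IsFiniteMeasure (P.withDensity (w fun _ ↦ c)) :=
    isFiniteMeasure_withDensity_ofReal hexp.2
  have hmap : (P.withDensity (w Y)).map Z' = (P.withDensity (w fun _ ↦ c)).map Z' := by
    refine ext_of_integral_exp_neg_nat_mul_eq fun n ↦ ?_
    rw [hlap hY hY0, hlap measurable_const fun _ ↦ hc, h n n.cast_nonneg, integral_mul_const,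
      mul_comm]
  rw [integral_eq_lintegral_of_nonneg_ae (ae_of_all _ hY0) hY.aestronglyMeasurable,
    ← huntilt hY, hmap, huntilt measurable_const]
  simp [hc]

/-- The density in `s` of the Laplace exponent at times `t` and coefficients `α`. -/
noncomputable def satoExponentDensity (H : ℝ) (ρ : Measure ℝ) {ι : Type*} [Fintype ι]
    (t α : ι → ℝ) (s : ℝ) : ℝ≥0∞ :=
  ∫⁻ x, ENNReal.ofReal (1 - Real.exp (-(∑ i, α i * (x * Real.exp (-s) *
    (if Real.exp (-s / H) ≤ t i then 1 else 0))))) ∂ρ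

theorem exp_neg_div_le_iff {H a s : ℝ} (hH : 0 < H) (ha : 0 < a) :
    Real.exp (-s / H) ≤ a ↔ -(H * Real.log a) ≤ s := by
  rw [← Real.le_log_iff_exp_le ha, div_le_iff₀ hH]
  constructor <;> intro h <;> linarith

theorem satoExponentDensity_eq_zero {H : ℝ} {ρ : Measure ℝ} {ι : Type*} [Fintype ι]
    {t α : ι → ℝ} {s : ℝ} (h : ∀ i, t i < Real.exp (-s / H)) :
    satoExponentDensity H ρ t α s = 0 := by
  simp [satoExponentDensity, fun i ↦ (h i).not_ge]

theorem lintegral_satoExponentDensity_ne_top {H : ℝ} (hH : 0 < H) {ρ : Measure ℝ}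
    (hρsupp : ρ (Set.Iic 0) = 0) (hρ : ∫⁻ x, ENNReal.ofReal x ∂ρ < ⊤)
    {ι : Type*} [Fintype ι] {t α : ι → ℝ} (ht : ∀ i, 0 ≤ t i) (hα : ∀ i, 0 ≤ α i) :
    ∫⁻ s, satoExponentDensity H ρ t α s ≠ ⊤ := by
  set T : ℝ := 1 + ∑ i, t i with hT
  have hT0 : 0 < T := by
    have : 0 ≤ ∑ i, t i := Finset.sum_nonneg fun i _ ↦ ht i
    linarith
  have htT (i) : t i < T := by
    have := Finset.single_le_sum (f := t) (fun i _ ↦ ht i) (Finset.mem_univ i)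
    linarith
  set c := -(H * Real.log T)
  have hpos : ∀ᵐ x ∂ρ, 0 < x := by
    rw [ae_iff]
    convert hρsupp using 2
    ext x
    simp
  have hα0 : 0 ≤ ∑ i, α i := Finset.sum_nonneg fun i _ ↦ hα i
  have hle (s) : satoExponentDensity H ρ t α s ≤ (Set.Ici c).indicator
      (fun s ↦ ENNReal.ofReal (Real.exp (-s)) *
        (ENNReal.ofReal (∑ i, α i) * ∫⁻ x, ENNReal.ofReal x ∂ρ)) s := by
    by_cases hs : s ∈ Set.Ici c
    · rw [Set.indicator_of_mem hs, ← mul_assoc, ← ENNReal.ofReal_mul (Real.exp_pos _).le,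
        ← lintegral_const_mul' _ _ ENNReal.ofReal_ne_top]
      refine lintegral_mono_ae (hpos.mono fun x hx ↦ ?_)
      rw [← ENNReal.ofReal_mul (by positivity)]
      refine ENNReal.ofReal_le_ofReal ?_
      calc _ ≤ ∑ i, α i * (x * Real.exp (-s) * (if Real.exp (-s / H) ≤ t i then 1 else 0)) := by
            rw [sub_le_comm]; exact Real.one_sub_le_exp_neg _
        _ ≤ ∑ i, α i * (x * Real.exp (-s)) := by
            refine Finset.sum_le_sum fun i _ ↦ mul_le_mul_of_nonneg_left ?_ (hα i)
            refine mul_le_of_le_one_right (by positivity) ?_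
            split_ifs <;> simp
        _ = _ := by rw [← Finset.sum_mul]; ring
    · rw [satoExponentDensity_eq_zero]
      · simp
      · intro i
        refine (htT i).trans (not_le.mp ?_)
        rwa [exp_neg_div_le_iff hH hT0]
  refine ((lintegral_mono hle).trans_lt ?_).ne
  have hfin : ∫⁻ s in Set.Ici c, ENNReal.ofReal (Real.exp (-s)) < ⊤ :=
    ((integrableOn_Ici_iff_integrableOn_Ioi).2 (integrableOn_exp_neg_Ioi c)).lintegral_lt_top
  rw [lintegral_indicator measurableSet_Ici, lintegral_mul_const _ (by fun_prop)]
  exact ENNReal.mul_lt_top hfin (ENNReal.mul_lt_top ENNReal.ofReal_lt_top hρ)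

/-- A family of times can be replaced by a strictly increasing one by grouping equal times. -/
theorem exists_strictMono_sum_eq {ι : Type*} [Fintype ι] (t α : ι → ℝ) (ht : ∀ i, 0 ≤ t i)
    (hα : ∀ i, 0 ≤ α i) :
    ∃ (n : ℕ) (u γ : Fin n → ℝ), (∀ i, 0 ≤ u i) ∧ StrictMono u ∧ (∀ i, 0 ≤ γ i) ∧
      ∀ f : ℝ → ℝ, ∑ i, γ i * f (u i) = ∑ i, α i * f (t i) := by
  classical
  let S : Finset ℝ := Finset.univ.image t
  let g (r : ℝ) : ℝ := ∑ i with t i = r, α i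
  let u := S.orderEmbOfFin rfl
  refine ⟨S.card, u, fun i ↦ g (u i), fun i ↦ ?_, u.strictMono,
    fun i ↦ Finset.sum_nonneg fun j _ ↦ hα j, fun f ↦ ?_⟩
  · obtain ⟨j, -, hj⟩ := Finset.mem_image.1 (S.orderEmbOfFin_mem rfl i)
    exact (ht j).trans_eq hj
  · have hsum : ∑ i, g (u i) * f (u i) = ∑ r ∈ S, g r * f r := by
      rw [← Finset.sum_coe_sort S fun r ↦ g r * f r,
        ← Equiv.sum_comp (S.orderIsoOfFin rfl).toEquiv]
      rfl
    rw [hsum, ← Finset.sum_fiberwise_of_maps_to (s := Finset.univ) (t := S) (g := t)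
      fun i _ ↦ Finset.mem_image_of_mem t (Finset.mem_univ i)]
    refine Finset.sum_congr rfl fun r _ ↦ ?_
    rw [Finset.sum_mul]
    refine Finset.sum_congr rfl fun i hi ↦ ?_
    rw [(Finset.mem_filter.1 hi).2]

/-- The exponent at the times `a, t₁ ∨ a, …` splits at `s = -H log a`. -/
theorem lintegral_satoExponentDensity_option {H : ℝ} (hH : 0 < H) (ρ : Measure ℝ)
    {ι : Type*} [Fintype ι] (t α : ι → ℝ) {a : ℝ} (ha : 0 < a) (β : ℝ) :
    ∫⁻ s, satoExponentDensity H ρ (fun o : Option ι ↦ o.elim a fun i ↦ max (t i) a)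
        (fun o ↦ o.elim β α) s =
      (∫⁻ s in Set.Iio (-(H * Real.log a)), satoExponentDensity H ρ t α s) +
        ∫⁻ s, satoExponentDensity H ρ (fun _ : Unit ↦ a) (fun _ ↦ β + ∑ i, α i) s := by
  have hlt {s : ℝ} (hs : s ∈ Set.Iio (-(H * Real.log a))) : ¬ Real.exp (-s / H) ≤ a := by
    rwa [exp_neg_div_le_iff hH ha, not_le]
  rw [← lintegral_add_compl (fun s ↦ satoExponentDensity H ρ (fun _ : Unit ↦ a) _ s)
      (measurableSet_Iio (a := -(H * Real.log a))),
    ← lintegral_add_compl _ (measurableSet_Iio (a := -(H * Real.log a)))]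
  rw [setLIntegral_congr_fun (f := fun s ↦ satoExponentDensity H ρ (fun _ : Unit ↦ a) _ s)
    (g := fun _ ↦ 0) measurableSet_Iio
    fun s hs ↦ satoExponentDensity_eq_zero fun _ ↦ not_le.1 (hlt hs)]
  rw [lintegral_zero, zero_add]
  congr 1
  · refine setLIntegral_congr_fun measurableSet_Iio fun s hs ↦ ?_
    simp [satoExponentDensity, Fintype.sum_option, hlt hs]
  · refine setLIntegral_congr_fun measurableSet_Iio.compl fun s hs ↦ ?_
    have hs' : Real.exp (-s / H) ≤ a := by
      rw [exp_neg_div_le_iff hH ha]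
      exact not_lt.1 hs
    simp [satoExponentDensity, Fintype.sum_option, hs', add_mul, Finset.sum_mul]

/-- for the nonnegative `H`-self-similar Sato process `ψ` with driving Lévy
measure `ρ`, the process `(ψ(t∨a) − ψ(a))_{t≥0}` (realizing the conditional law of `ψ`
given `ψ(a) = 0`) has Laplace transforms given by the Lévy measure
`ν_a(F) = ∫_{−∞}^{−H ln a} ∫₀^∞ F(x e^{−s} 1_{[e^{−s/H},∞)}) ρ(dx) ds`,
the restriction of the Lévy measure of `ψ` to paths vanishing at `a`. -/
theorem sato_conditioned_laplace {Ω : Type*} [MeasurableSpace Ω] (P : Measure Ω)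
    [IsProbabilityMeasure P] (H : ℝ) (hH : 0 < H)
    (ρ : Measure ℝ) [SigmaFinite ρ] (hρsupp : ρ (Set.Iic 0) = 0)
    (hκρ : ∫⁻ x, ENNReal.ofReal x ∂ρ < ⊤)
    (ψ : ℝ → Ω → ℝ) (hψmeas : ∀ t, Measurable (ψ t)) (hψnonneg : ∀ t ω, 0 ≤ ψ t ω)
    (hLaplace : ∀ (n : ℕ) (t α : Fin n → ℝ),
      (∀ i, 0 ≤ t i) → StrictMono t → (∀ i, 0 ≤ α i) →
      ∫ ω, Real.exp (-(∑ i, α i * ψ (t i) ω)) ∂P =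
        Real.exp (-(∫⁻ s : ℝ, ∫⁻ x, ENNReal.ofReal
          (1 - Real.exp (-(∑ i, α i * (x * Real.exp (-s) *
            (if Real.exp (-s / H) ≤ t i then 1 else 0))))) ∂ρ).toReal))
    (a : ℝ) (ha : 0 < a)
    (n : ℕ) (t α : Fin n → ℝ)
    (ht0 : ∀ i, 0 ≤ t i) (htmono : StrictMono t) (hα : ∀ i, 0 ≤ α i) :
    ∫ ω, Real.exp (-(∑ i, α i * (ψ (max (t i) a) ω - ψ a ω))) ∂P =
      Real.exp (-(∫⁻ s in Set.Iio (-(H * Real.log a)), ∫⁻ x, ENNReal.ofReal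
        (1 - Real.exp (-(∑ i, α i * (x * Real.exp (-s) *
          (if Real.exp (-s / H) ≤ t i then 1 else 0))))) ∂ρ).toReal) := by
  have hLap {ι : Type} [Fintype ι] (u γ : ι → ℝ) (hu : ∀ i, 0 ≤ u i) (hγ : ∀ i, 0 ≤ γ i) :
      ∫ ω, Real.exp (-(∑ i, γ i * ψ (u i) ω)) ∂P =
        Real.exp (-(∫⁻ s, satoExponentDensity H ρ u γ s).toReal) := by
    obtain ⟨m, v, δ, hv, hvmono, hδ, hsum⟩ := exists_strictMono_sum_eq u γ hu hγ
    have key := hLaplace m v δ hv hvmono hδ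
    simp only [fun ω ↦ hsum fun r ↦ ψ r ω, fun x s : ℝ ↦ hsum fun r ↦
      x * Real.exp (-s) * (if Real.exp (-s / H) ≤ r then 1 else 0)] at key
    exact key
  have hA : 0 ≤ ∑ i, α i := Finset.sum_nonneg fun i _ ↦ hα i
  have htop {ι : Type} [Fintype ι] {u γ : ι → ℝ} (hu : ∀ i, 0 ≤ u i) (hγ : ∀ i, 0 ≤ γ i) :=
    lintegral_satoExponentDensity_ne_top hH hρsupp hκρ hu hγ
  have htilt (β : ℝ) (ω : Ω) :
      Real.exp (-((β + ∑ i, α i) * ψ a ω)) *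
        Real.exp (-(∑ i, α i * (ψ (max (t i) a) ω - ψ a ω))) =
      Real.exp (-(β * ψ a ω + ∑ i, α i * ψ (max (t i) a) ω)) := by
    rw [← Real.exp_add]
    simp only [mul_sub, Finset.sum_sub_distrib, ← Finset.sum_mul]
    ring_nf
  refine integral_eq_of_tilted_laplace_eq (Z := ψ a) (A := ∑ i, α i) (by fun_prop)
    (fun _ ↦ (Real.exp_pos _).le) (hψmeas a) (hψnonneg a) hA (Real.exp_pos _).le ?_ fun β hβ ↦ ?_
  · have h0 := htilt 0
    simp only [zero_add, zero_mul] at h0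
    simp only [h0]
    refine Integrable.of_bound (C := 1) (by fun_prop) (ae_of_all _ fun ω ↦ ?_)
    rw [Real.norm_eq_abs, Real.abs_exp, Real.exp_le_one_iff, neg_nonpos]
    exact Finset.sum_nonneg fun i _ ↦ mul_nonneg (hα i) (hψnonneg _ ω)
  · have hjoint := hLap (fun o : Option (Fin n) ↦ o.elim a fun i ↦ max (t i) a)
      (fun o ↦ o.elim β α) (by rintro (_ | i) <;> simp [ha.le])
      (by rintro (_ | i) <;> simp [hβ, hα])
    have hmarg := hLap (fun _ : Unit ↦ a) (fun _ ↦ β + ∑ i, α i) (fun _ ↦ ha.le)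
      fun _ ↦ add_nonneg hβ hA
    simp only [Fintype.sum_option, Option.elim_none, Option.elim_some] at hjoint
    simp only [Finset.univ_unique, Finset.sum_singleton] at hmarg
    simp only [htilt]
    rw [hjoint, hmarg, lintegral_satoExponentDensity_option hH ρ t α ha β,
      ENNReal.toReal_add ((setLIntegral_le_lintegral _ _).trans_lt (htop ht0 hα).lt_top).ne
        (htop (fun _ ↦ ha.le) fun _ ↦ add_nonneg hβ hA), neg_add, Real.exp_add]
    rfl
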